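/- arXiv:1204.0529 — 2 statements merged into one kernel-verified Lean document; each statement's English description precedes it below -/
import Mathlib

section
/- Let β ∈ (0,1). There exists a constant C = C(β) > 0 such that: for every bounded measurable f : ℝ³ × [0,1] → ℝ, the function v : ℝ³ × [0,1] → ℝ³ defined by v(x,t) := ∫₀^t ∫_{ℝ³} ∇ₓG(x−y, t−s) f(y,s) dy ds, where G(x,t) = (4πt)^{−3/2} e^{−|x|²/(4t)} is the Gaussian heat kernel on ℝ³, satisfies ‖v‖_{C^β_par(ℝ³×[0,1])} ≤ C·‖f‖_{L^∞(ℝ³×[0,1])}. -/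
open MeasureTheory Real Filter Set Metric

noncomputable section

abbrev R3 : Type := EuclideanSpace ℝ (Fin 3)

/-- standard basis vectors of `ℝ³` -/
def ee (i : Fin 3) : R3 := EuclideanSpace.single i (1 : ℝ)

/-- spatial partial derivative of a scalar function -/
def pd (f : R3 → ℝ) (i : Fin 3) (x : R3) : ℝ := fderiv ℝ f x (ee i)

/-- spatial Laplacian of a scalar function -/
def lap (f : R3 → ℝ) (x : R3) : ℝ := ∑ i, pd (pd f i) i x

/-- time derivative -/
def dtt (φ : R3 → ℝ → ℝ) (x : R3) (t : ℝ) : ℝ := deriv (fun s => φ x s) t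

/-- spatial partial derivative at fixed time -/
def pdAt (φ : R3 → ℝ → ℝ) (i : Fin 3) (x : R3) (t : ℝ) : ℝ := pd (fun y => φ y t) i x

/-- spatial Laplacian at fixed time -/
def lapAt (φ : R3 → ℝ → ℝ) (x : R3) (t : ℝ) : ℝ := lap (fun y => φ y t) x

/-- parabolic distance on space-time -/
def pdist (z w : R3 × ℝ) : ℝ := ‖z.1 - w.1‖ + Real.sqrt |z.2 - w.2|

/-- scalar test function compactly supported in the open space-time set `O` -/
def IsTest (φ : R3 → ℝ → ℝ) (O : Set (R3 × ℝ)) : Prop :=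
  ContDiff ℝ (⊤ : ℕ∞) (fun z : R3 × ℝ => φ z.1 z.2) ∧
    HasCompactSupport (fun z : R3 × ℝ => φ z.1 z.2) ∧
    tsupport (fun z : R3 × ℝ => φ z.1 z.2) ⊆ O

/-- divergence free, distributionally, for a steady vector field on `ℝ³` -/
def DivFree (v : R3 → R3) : Prop :=
  ∀ φ : R3 → ℝ, ContDiff ℝ (⊤ : ℕ∞) φ → HasCompactSupport φ →
    (∫ x : R3, ∑ i, v x i * pd φ i x) = 0

/-- divergence free, distributionally, in a space-time set -/
def DivFreeOn (v : R3 → ℝ → R3) (O : Set (R3 × ℝ)) : Prop :=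
  ∀ φ : R3 → ℝ → ℝ, IsTest φ O →
    (∫ z : R3 × ℝ, ∑ i, v z.1 z.2 i * pdAt φ i z.1 z.2) = 0

/-- `gu` is the (weak) spatial gradient of `u` in `O`; `gu x t i j = ∂ⱼ uᵢ` -/
def WeakGradOn (u : R3 → ℝ → R3) (gu : R3 → ℝ → Fin 3 → Fin 3 → ℝ)
    (O : Set (R3 × ℝ)) : Prop :=
  ∀ φ : R3 → ℝ → ℝ, IsTest φ O → ∀ i j,
    (∫ z : R3 × ℝ, u z.1 z.2 i * pdAt φ j z.1 z.2) =
      - ∫ z : R3 × ℝ, gu z.1 z.2 i j * φ z.1 z.2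

/-- `|∇u|²` -/
def gradSq (gu : R3 → ℝ → Fin 3 → Fin 3 → ℝ) (x : R3) (t : ℝ) : ℝ :=
  ∑ i, ∑ j, (gu x t i j) ^ 2

/-- distributional form of `∂ₜu − Δu + a·∇u + div(a⊗u) + u·∇u + ∇p = 0`, `div a = div u = 0` -/
def PNSE (a u : R3 → ℝ → R3) (p : R3 → ℝ → ℝ) (O : Set (R3 × ℝ)) : Prop :=
  ∀ φ : Fin 3 → R3 → ℝ → ℝ, (∀ i, IsTest (φ i) O) →
    (∫ z : R3 × ℝ,
      ((∑ i, u z.1 z.2 i * (dtt (φ i) z.1 z.2 + lapAt (φ i) z.1 z.2)) +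
       (∑ i, ∑ j, (u z.1 z.2 i * u z.1 z.2 j + a z.1 z.2 i * u z.1 z.2 j +
          u z.1 z.2 i * a z.1 z.2 j) * pdAt (φ i) j z.1 z.2) +
       p z.1 z.2 * (∑ i, pdAt (φ i) i z.1 z.2))) = 0

/-- the local energy inequality for the `a`-perturbed Navier–Stokes system -/
def LocalEnergyIneq (a u : R3 → ℝ → R3) (gu : R3 → ℝ → Fin 3 → Fin 3 → ℝ)
    (p : R3 → ℝ → ℝ) (O : Set (R3 × ℝ)) : Prop :=
  ∀ φ : R3 → ℝ → ℝ, IsTest φ O → (∀ x t, 0 ≤ φ x t) →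
    (∫ z : R3 × ℝ, gradSq gu z.1 z.2 * φ z.1 z.2) ≤
      ∫ z : R3 × ℝ,
        ((‖u z.1 z.2‖ ^ 2 / 2) * (dtt φ z.1 z.2 + lapAt φ z.1 z.2) +
         (‖u z.1 z.2‖ ^ 2 / 2) * (∑ j, (u z.1 z.2 j + a z.1 z.2 j) * pdAt φ j z.1 z.2) +
         (∑ i, ∑ j, a z.1 z.2 i * u z.1 z.2 j * gu z.1 z.2 i j) * φ z.1 z.2 +
         (∑ i, ∑ j, a z.1 z.2 i * u z.1 z.2 j * u z.1 z.2 i * pdAt φ j z.1 z.2) +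
         p z.1 z.2 * (∑ i, u z.1 z.2 i * pdAt φ i z.1 z.2))

/-- `u ∈ L^∞_t L²_x ∩ L²_t Ḣ¹_x` on compact subsets of `O` -/
def LocEnergyClass (u : R3 → ℝ → R3) (gu : R3 → ℝ → Fin 3 → Fin 3 → ℝ)
    (O : Set (R3 × ℝ)) : Prop :=
  ∀ K : Set (R3 × ℝ), IsCompact K → K ⊆ O →
    ∃ C : ℝ,
      (∀ᵐ t : ℝ, (∫ x in {x : R3 | (x, t) ∈ K}, ‖u x t‖ ^ 2) ≤ C) ∧
      (∫ z in K, gradSq gu z.1 z.2) ≤ C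

/-- `p ∈ L^{3/2}_loc(O)` -/
def PLoc (p : R3 → ℝ → ℝ) (O : Set (R3 × ℝ)) : Prop :=
  ∀ K : Set (R3 × ℝ), IsCompact K → K ⊆ O →
    IntegrableOn (fun z : R3 × ℝ => |p z.1 z.2| ^ (3 / 2 : ℝ)) K

/-- suitable weak solution of the `a`-perturbed Navier–Stokes system in `O` -/
def SuitableWeakSolution (a u : R3 → ℝ → R3) (p : R3 → ℝ → ℝ) (O : Set (R3 × ℝ)) : Prop :=
  ∃ gu : R3 → ℝ → Fin 3 → Fin 3 → ℝ,
    WeakGradOn u gu O ∧ LocEnergyClass u gu O ∧ PLoc p O ∧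
      PNSE a u p O ∧ DivFreeOn u O ∧ LocalEnergyIneq a u gu p O

/-- the parabolic cylinder `Q(R, z₀)` -/
def Qb (R : ℝ) (z₀ : R3 × ℝ) : Set (R3 × ℝ) := (ball z₀.1 R) ×ˢ (Ioc (z₀.2 - R ^ 2) z₀.2)

def Q1 : Set (R3 × ℝ) := Qb 1 (0, 0)

/-- average of `u` over a space-time set -/
def uavg (u : R3 → ℝ → R3) (S : Set (R3 × ℝ)) : R3 := ⨍ z in S, u z.1 z.2 ∂volume

/-- spatial average of the pressure at time `t` -/
def pavgX (p : R3 → ℝ → ℝ) (x₀ : R3) (R t : ℝ) : ℝ := ⨍ x in ball x₀ R, p x t ∂volume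

/-- the quantity `Y(u, p, Q(R, z₀))` -/
def Yquant (u : R3 → ℝ → R3) (p : R3 → ℝ → ℝ) (R : ℝ) (z₀ : R3 × ℝ) : ℝ :=
  (⨍ z in Qb R z₀, ‖u z.1 z.2 - uavg u (Qb R z₀)‖ ^ 3 ∂volume) ^ ((1 : ℝ) / 3) +
    R * (⨍ z in Qb R z₀, |p z.1 z.2 - pavgX p z₀.1 R z.2| ^ (3 / 2 : ℝ) ∂volume) ^ ((2 : ℝ) / 3)

/-- `a ∈ L^m(S)` -/
def MemLmOn (a : R3 → ℝ → R3) (m : ℝ) (S : Set (R3 × ℝ)) : Prop :=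
  IntegrableOn (fun z : R3 × ℝ => ‖a z.1 z.2‖ ^ m) S

/-- `(∫_S |a|^m)^{1/m}` -/
def LmNorm (a : R3 → ℝ → R3) (m : ℝ) (S : Set (R3 × ℝ)) : ℝ :=
  (∫ z in S, ‖a z.1 z.2‖ ^ m) ^ (1 / m)

/-- `(⨍_S |a|^m)^{1/m}` -/
def LmAvg (a : R3 → ℝ → R3) (m : ℝ) (S : Set (R3 × ℝ)) : ℝ :=
  (⨍ z in S, ‖a z.1 z.2‖ ^ m ∂volume) ^ (1 / m)

/-- `u` agrees a.e. on `S` with `v`, and `v` is parabolically Hölder on `S` with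
exponent `α` and constant `C` -/
def HolderAE (u v : R3 → ℝ → R3) (S : Set (R3 × ℝ)) (α C : ℝ) : Prop :=
  (∀ᵐ z : R3 × ℝ, z ∈ S → u z.1 z.2 = v z.1 z.2) ∧
    (∀ z ∈ S, ‖v z.1 z.2‖ ≤ C) ∧
    (∀ z ∈ S, ∀ w ∈ S, ‖v z.1 z.2 - v w.1 w.2‖ ≤ C * pdist z w ^ α)

/-- the space-time upper half space `ℝ³ × (0,∞)` -/
def posT : Set (R3 × ℝ) := (univ : Set R3) ×ˢ Ioi (0 : ℝ)

/-- Leray solution with initial data `u₀`, with weak gradient `gu` and pressure `p` -/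
def IsLeraySolutionWith (u : R3 → ℝ → R3) (gu : R3 → ℝ → Fin 3 → Fin 3 → ℝ)
    (p : R3 → ℝ → ℝ) (u₀ : R3 → R3) : Prop :=
  (∀ K : Set (R3 × ℝ), IsCompact K → IntegrableOn (fun z : R3 × ℝ => ‖u z.1 z.2‖ ^ 2) K) ∧
  WeakGradOn u gu posT ∧
  (∀ R : ℝ, 0 < R →
    (∃ C : ℝ,
      (∀ᵐ t ∂(volume.restrict (Ico (0 : ℝ) (R ^ 2))), ∀ x₀ : R3,
        (∫ x in ball x₀ R, ‖u x t‖ ^ 2 / 2) ≤ C) ∧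
      (∀ x₀ : R3, (∫ z in (ball x₀ R) ×ˢ (Ioo (0 : ℝ) (R ^ 2)), gradSq gu z.1 z.2) ≤ C)) ∧
    Tendsto (fun x₀ : R3 => ∫ z in (ball x₀ R) ×ˢ (Ioo (0 : ℝ) (R ^ 2)), ‖u z.1 z.2‖ ^ 2)
      (cocompact R3) (nhds 0)) ∧
  PLoc p posT ∧
  PNSE (fun _ _ => (0 : R3)) u p posT ∧
  DivFreeOn u posT ∧
  (∀ K : Set R3, IsCompact K →
    Tendsto (fun t : ℝ => ∫ x in K, ‖u x t - u₀ x‖ ^ 2) (nhdsWithin 0 (Ioi 0)) (nhds 0)) ∧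
  LocalEnergyIneq (fun _ _ => (0 : R3)) u gu p posT

/-- the heat kernel on `ℝ³` -/
def heatK (t : ℝ) (x : R3) : ℝ := (4 * π * t) ^ (-(3 : ℝ) / 2) * Real.exp (-‖x‖ ^ 2 / (4 * t))

/-- heat extension of `u₀` at time `1` -/
def heatExt (u₀ : R3 → R3) (x : R3) : R3 := ∫ y : R3, heatK 1 (x - y) • u₀ y

/-- spatial gradient of the heat kernel -/
def gradHeatK (t : ℝ) (x : R3) : R3 := (-(1 / (2 * t)) * heatK t x) • x

/-- prefactor -/
def Pf (t : ℝ) : ℝ := 1 / (2 * t) * (4 * π * t) ^ (-(3 : ℝ) / 2)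

/-- dominating Gaussian -/
def Gd (t : ℝ) (z : R3) : ℝ := Pf t * √t * Real.exp (-(1 / (16 * t)) * ‖z‖ ^ 2)

lemma Pf_pos {t : ℝ} (ht : 0 < t) : 0 < Pf t := by
  unfold Pf; positivity

lemma poly_exp {u q : ℝ} (h : q ≤ 1000 * (1 + u ^ 2 / 16 + u ^ 4 / 512)) :
    q * Real.exp (-u ^ 2 / 8) ≤ 1000 * Real.exp (-u ^ 2 / 16) := by
  have h1 : 1 + u ^ 2 / 16 + u ^ 4 / 512 ≤ Real.exp (u ^ 2 / 16) := by
    have := Real.quadratic_le_exp_of_nonneg (x := u ^ 2 / 16) (by positivity)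
    nlinarith
  have h2 : Real.exp (-u ^ 2 / 16) = Real.exp (u ^ 2 / 16) * Real.exp (-u ^ 2 / 8) := by
    rw [← Real.exp_add]; congr 1; ring
  rw [h2, ← mul_assoc]
  gcongr
  linarith

lemma poly_exp4 {u q : ℝ} (hq : 0 ≤ q) (h : q ≤ 1000 * (1 + u ^ 2 / 16 + u ^ 4 / 512)) :
    q * Real.exp (-u ^ 2 / 4) ≤ 1000 * Real.exp (-u ^ 2 / 16) := by
  refine le_trans ?_ (poly_exp h)
  have : Real.exp (-u ^ 2 / 4) ≤ Real.exp (-u ^ 2 / 8) :=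
    Real.exp_le_exp.2 (by nlinarith [sq_nonneg u])
  gcongr

lemma exp_diff {a b : ℝ} : |Real.exp (-a) - Real.exp (-b)| ≤ |a - b| * (Real.exp (-a) + Real.exp (-b)) := by
  have key : ∀ a b : ℝ, a ≤ b → |Real.exp (-a) - Real.exp (-b)| ≤ |a - b| * (Real.exp (-a) + Real.exp (-b)) := by
    intro a b hab
    have h1 : Real.exp (-b) ≤ Real.exp (-a) := Real.exp_le_exp.2 (by linarith)
    have h2 : Real.exp (-b) = Real.exp (-a) * Real.exp (a - b) := by
      rw [← Real.exp_add]; congr 1; ring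
    have h3 := Real.add_one_le_exp (a - b)
    have h4 := Real.exp_pos (-a)
    have h5 := Real.exp_pos (-b)
    rw [abs_of_nonneg (by linarith), abs_of_nonpos (by linarith)]
    nlinarith
  rcases le_total a b with h | h
  · exact key a b h
  · have := key b a h
    rw [abs_sub_comm, abs_sub_comm a b, add_comm]; exact this

lemma space_1d {u u' η : ℝ} (hu : 0 ≤ u) (hu' : 0 ≤ u') (h1 : |u - u'| ≤ η) (h2 : η ≤ 1) :
    η * Real.exp (-u' ^ 2 / 4) + u * |Real.exp (-u ^ 2 / 4) - Real.exp (-u' ^ 2 / 4)| ≤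
      η * (2000 * (Real.exp (-u ^ 2 / 16) + Real.exp (-u' ^ 2 / 16))) := by
  have hη : 0 ≤ η := (abs_nonneg _).trans h1
  obtain ⟨h3, h4⟩ := abs_le.1 h1
  have hd := exp_diff (a := u ^ 2 / 4) (b := u' ^ 2 / 4)
  rw [← neg_div, ← neg_div] at hd
  have hab : |u ^ 2 / 4 - u' ^ 2 / 4| ≤ η * ((u + u') / 4) := by
    rw [show u ^ 2 / 4 - u' ^ 2 / 4 = (u - u') * ((u + u') / 4) by ring, abs_mul,
      abs_of_nonneg (show 0 ≤ (u + u') / 4 by positivity)]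
    gcongr
  have e1 := poly_exp4 (u := u') (q := 1) (by norm_num) (by nlinarith [sq_nonneg u', sq_nonneg (u' ^ 2)])
  have e2 := poly_exp4 (u := u) (q := u * (u + u') / 4) (by positivity) (by nlinarith [sq_nonneg u, sq_nonneg (u ^ 2)])
  have e3 := poly_exp4 (u := u') (q := u * (u + u') / 4) (by positivity) (by
    have : u * (u + u') ≤ (u' + 1) * (2 * u' + 1) := by
      apply mul_le_mul <;> linarith
    nlinarith [sq_nonneg u', sq_nonneg (u' ^ 2)])
  have e4 := Real.exp_pos (-u ^ 2 / 16)
  have e5 := Real.exp_pos (-u' ^ 2 / 16)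
  calc _ ≤ η * Real.exp (-u' ^ 2 / 4) + u * (η * ((u + u') / 4) * (Real.exp (-u ^ 2 / 4) + Real.exp (-u' ^ 2 / 4))) := by
        gcongr
        exact hd.trans (by gcongr)
    _ = η * (1 * Real.exp (-u' ^ 2 / 4) + u * (u + u') / 4 * Real.exp (-u ^ 2 / 4)
          + u * (u + u') / 4 * Real.exp (-u' ^ 2 / 4)) := by ring
    _ ≤ _ := by gcongr; linarith

lemma gradHeatK_eq (t : ℝ) (z : R3) :
    gradHeatK t z = -((Pf t * Real.exp (-‖z‖ ^ 2 / (4 * t))) • z) := by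
  unfold gradHeatK heatK Pf
  rw [← neg_smul]; congr 1; ring

lemma e4 {t : ℝ} (ht : 0 < t) (z : R3) : -‖z‖ ^ 2 / (4 * t) = -(‖z‖ / √t) ^ 2 / 4 := by
  rw [div_pow, Real.sq_sqrt ht.le]; field_simp

lemma e16 {t : ℝ} (ht : 0 < t) (z : R3) : -(1 / (16 * t)) * ‖z‖ ^ 2 = -(‖z‖ / √t) ^ 2 / 16 := by
  rw [div_pow, Real.sq_sqrt ht.le]; field_simp

lemma K_bound {t : ℝ} (ht : 0 < t) (z : R3) : ‖gradHeatK t z‖ ≤ 1000 * Gd t z := by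
  have hP := Pf_pos ht
  have hs : 0 < √t := Real.sqrt_pos.2 ht
  rw [gradHeatK_eq, norm_neg, norm_smul, Real.norm_of_nonneg (by positivity), Gd, e4 ht, e16 ht]
  have := poly_exp4 (u := ‖z‖ / √t) (q := ‖z‖ / √t) (by positivity) (by
    have : 0 ≤ ‖z‖ / √t := by positivity
    nlinarith [sq_nonneg (‖z‖ / √t - 1), sq_nonneg ((‖z‖ / √t) ^ 2)])
  set u := ‖z‖ / √t with hu
  have hz : ‖z‖ = √t * u := by rw [hu]; field_simp
  calc _ = Pf t * √t * (u * Real.exp (-u ^ 2 / 4)) := by rw [hz]; ring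
    _ ≤ Pf t * √t * (1000 * Real.exp (-u ^ 2 / 16)) := by gcongr
    _ = _ := by ring

lemma Gd_nonneg {t : ℝ} (ht : 0 < t) (z : R3) : 0 ≤ Gd t z := by
  have hP := Pf_pos ht
  unfold Gd; positivity

lemma K_space {β : ℝ} (hβ : β ∈ Ioo (0 : ℝ) 1) {t : ℝ} (ht : 0 < t) (z z' : R3) :
    ‖gradHeatK t z - gradHeatK t z'‖ ≤ (‖z - z'‖ / √t) ^ β * (2000 * (Gd t z + Gd t z')) := by
  have hP := Pf_pos ht
  have hs : 0 < √t := Real.sqrt_pos.2 ht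
  have g1 := Gd_nonneg ht z
  have g2 := Gd_nonneg ht z'
  set η := ‖z - z'‖ / √t with hη
  have hη0 : 0 ≤ η := by positivity
  rcases le_total η 1 with h | h
  · have hηβ : η ≤ η ^ β := by
      rcases hη0.eq_or_lt with h0 | h0
      · rw [← h0, Real.zero_rpow hβ.1.ne']
      · exact Real.self_le_rpow_of_le_one h0.le h hβ.2.le
    have key : ‖gradHeatK t z - gradHeatK t z'‖ ≤ η * (2000 * (Gd t z + Gd t z')) := by
      have hd : |‖z‖ / √t - ‖z'‖ / √t| ≤ η := by
        rw [← sub_div, abs_div, abs_of_pos hs, hη]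
        gcongr
        exact abs_norm_sub_norm_le z z'
      have := space_1d (u := ‖z‖ / √t) (u' := ‖z'‖ / √t) (by positivity) (by positivity) hd h
      rw [gradHeatK_eq, gradHeatK_eq, Gd, Gd, e4 ht, e4 ht, e16 ht, e16 ht]
      set u := ‖z‖ / √t with hu
      set u' := ‖z'‖ / √t with hu'
      have hz : ‖z‖ = √t * u := by rw [hu]; field_simp
      have hzz : ‖z - z'‖ = √t * η := by rw [hη]; field_simp
      set E := Real.exp (-u ^ 2 / 4)
      set E' := Real.exp (-u' ^ 2 / 4)
      have hE' : 0 < E' := Real.exp_pos _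
      have : -((Pf t * E) • z) - -((Pf t * E') • z') = -(Pf t • (E' • (z - z') + (E - E') • z)) := by
        simp only [smul_sub, smul_add, sub_smul, mul_smul]; abel
      rw [this, norm_neg, norm_smul, Real.norm_of_nonneg hP.le]
      calc _ ≤ Pf t * (E' * ‖z - z'‖ + |E - E'| * ‖z‖) := by
            gcongr
            refine (norm_add_le _ _).trans ?_
            rw [norm_smul, norm_smul, Real.norm_of_nonneg hE'.le, Real.norm_eq_abs]
        _ = Pf t * √t * (η * E' + u * |E - E'|) := by rw [hz, hzz]; ring
        _ ≤ Pf t * √t * (η * (2000 * (Real.exp (-u ^ 2 / 16) + Real.exp (-u' ^ 2 / 16)))) := by gcongr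
        _ = _ := by ring
    exact key.trans (by gcongr)
  · have h1 : 1 ≤ η ^ β := Real.one_le_rpow h hβ.1.le
    calc _ ≤ 1000 * Gd t z + 1000 * Gd t z' := (norm_sub_le _ _).trans (add_le_add (K_bound ht z) (K_bound ht z'))
      _ ≤ 1 * (2000 * (Gd t z + Gd t z')) := by linarith
      _ ≤ _ := by gcongr

lemma Pf_diff {t t' : ℝ} (ht : 0 < t) (h : t ≤ t') :
    Pf t' ≤ Pf t ∧ Pf t - Pf t' ≤ Pf t * (3 * ((t' - t) / t)) := by
  have ht' : 0 < t' := ht.trans_le h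
  have hP := Pf_pos ht
  have hq : (t / t') ^ (3 / 2 : ℝ) ≤ 1 := Real.rpow_le_one (by positivity) ((div_le_one ht').2 h) (by norm_num)
  have hq2 : (t / t') ^ 2 ≤ (t / t') ^ (3 / 2 : ℝ) := by
    rw [← Real.rpow_natCast]
    exact Real.rpow_le_rpow_of_exponent_ge (by positivity) ((div_le_one ht').2 h) (by norm_num)
  have hm1 : t / t' ≤ 1 := (div_le_one ht').2 h
  have hm0 : 0 < t / t' := by positivity
  have heq : Pf t' = Pf t * ((t / t') * (t / t') ^ (3 / 2 : ℝ)) := by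
    unfold Pf
    have : 4 * π * t' = (4 * π * t) * (t / t')⁻¹ := by field_simp
    rw [this, Real.mul_rpow (by positivity) (by positivity), Real.inv_rpow hm0.le, ← Real.rpow_neg hm0.le]
    rw [show -(-(3 : ℝ) / 2) = 3 / 2 by ring]
    field_simp
  have hδ : 1 - t / t' ≤ (t' - t) / t := by
    rw [show 1 - t / t' = (t' - t) / t' by field_simp]
    gcongr
  set m := t / t'
  set r := m ^ (3 / 2 : ℝ)
  have hr : 0 < r := Real.rpow_pos_of_pos hm0 _
  rw [heq]
  constructor
  · have : m * r ≤ 1 := by nlinarith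
    nlinarith
  · have : 1 - m * r ≤ 3 * ((t' - t) / t) := by
      have : m * m ^ 2 ≤ m * r := by gcongr
      nlinarith [sq_nonneg (m - 1), sq_nonneg m]
    calc _ = Pf t * (1 - m * r) := by ring
      _ ≤ _ := by gcongr

lemma K_time {β : ℝ} (hβ : β ∈ Ioo (0 : ℝ) 1) {t t' : ℝ} (ht : 0 < t) (h : t ≤ t') (z : R3) :
    ‖gradHeatK t' z - gradHeatK t z‖ ≤ ((t' - t) / t) ^ (β / 2) * (2000 * (Gd t z + Gd t' z)) := by
  have hb := hβ.1
  have hb1 := hβ.2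
  have ht' : 0 < t' := ht.trans_le h
  have hP := Pf_pos ht
  have hP' := Pf_pos ht'
  have hs : 0 < √t := Real.sqrt_pos.2 ht
  have g1 := Gd_nonneg ht z
  have g2 := Gd_nonneg ht' z
  set δ := (t' - t) / t with hδ
  have hδ0 : 0 ≤ δ := div_nonneg (by linarith) ht.le
  rcases le_total δ 1 with hd | hd
  · have hηβ : δ ≤ δ ^ (β / 2) := by
      rcases hδ0.eq_or_lt with h0 | h0
      · rw [← h0, Real.zero_rpow (by positivity)]
      · exact Real.self_le_rpow_of_le_one h0.le hd (by linarith)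
    obtain ⟨p1, p2⟩ := Pf_diff ht h
    rw [← hδ] at p2
    have ht2 : t' ≤ 2 * t := by
      rw [hδ, div_le_one ht] at hd; linarith
    have key : ‖gradHeatK t' z - gradHeatK t z‖ ≤ δ * (2000 * Gd t z) := by
      rw [gradHeatK_eq, gradHeatK_eq]
      set E := Real.exp (-‖z‖ ^ 2 / (4 * t)) with hE
      set E' := Real.exp (-‖z‖ ^ 2 / (4 * t')) with hE'
      rw [neg_sub_neg, ← sub_smul, norm_smul, Real.norm_eq_abs, Gd, e16 ht]
      set u := ‖z‖ / √t with hu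
      have hu0 : 0 ≤ u := by positivity
      have hz : ‖z‖ = √t * u := by rw [hu]; field_simp
      have hz2 : ‖z‖ ^ 2 = t * u ^ 2 := by rw [hz, mul_pow, Real.sq_sqrt ht.le]
      have hE'u : E' ≤ Real.exp (-u ^ 2 / 8) := by
        rw [hE']; apply Real.exp_le_exp.2
        rw [hz2, div_le_div_iff₀ (by positivity) (by norm_num)]
        nlinarith [sq_nonneg u]
      have hE0 : 0 < E := Real.exp_pos _
      have hE'0 : 0 < E' := Real.exp_pos _
      have hEE : E ≤ E' := by
        rw [hE', hE]; apply Real.exp_le_exp.2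
        rw [neg_div, neg_div]; gcongr
      have hdiff : E' - E ≤ u ^ 2 / 4 * δ * E' := by
        have h1 : E = E' * Real.exp (-‖z‖ ^ 2 / (4 * t) + ‖z‖ ^ 2 / (4 * t')) := by
          rw [hE, hE', ← Real.exp_add]; congr 1; ring
        have h2 := Real.add_one_le_exp (-‖z‖ ^ 2 / (4 * t) + ‖z‖ ^ 2 / (4 * t'))
        have h3 : -(-‖z‖ ^ 2 / (4 * t) + ‖z‖ ^ 2 / (4 * t')) ≤ u ^ 2 / 4 * δ := by
          rw [hz2]
          have : -(-(t * u ^ 2) / (4 * t) + t * u ^ 2 / (4 * t')) = u ^ 2 / 4 * ((t' - t) / t') := by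
            field_simp; ring
          rw [this, hδ]
          gcongr
        have h4 : 1 - u ^ 2 / 4 * δ ≤ Real.exp (-‖z‖ ^ 2 / (4 * t) + ‖z‖ ^ 2 / (4 * t')) := by linarith
        have h5 := mul_le_mul_of_nonneg_left h4 hE'0.le
        rw [← h1] at h5
        nlinarith
      have habs : |Pf t * E - Pf t' * E'| ≤ Pf t * (δ * (3 + u ^ 2 / 4)) * E' := by
        have a1 : Pf t * (E' - E) ≤ Pf t * (u ^ 2 / 4 * δ * E') := by gcongr
        have a2 : (Pf t - Pf t') * E' ≤ Pf t * (3 * δ) * E' := by gcongr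
        have a3 : 0 ≤ Pf t * (E' - E) := mul_nonneg hP.le (by linarith)
        have a4 : 0 ≤ (Pf t - Pf t') * E' := mul_nonneg (by linarith) hE'0.le
        rw [abs_le]; constructor <;> nlinarith
      have := poly_exp (u := u) (q := u * (3 + u ^ 2 / 4)) (by
        nlinarith [sq_nonneg (u - 1), sq_nonneg (u ^ 2 - u), sq_nonneg (u ^ 2)])
      calc _ ≤ Pf t * (δ * (3 + u ^ 2 / 4)) * E' * (√t * u) := by rw [hz]; gcongr
        _ ≤ Pf t * (δ * (3 + u ^ 2 / 4)) * Real.exp (-u ^ 2 / 8) * (√t * u) := by gcongr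
        _ = Pf t * √t * δ * (u * (3 + u ^ 2 / 4) * Real.exp (-u ^ 2 / 8)) := by ring
        _ ≤ Pf t * √t * δ * (1000 * Real.exp (-u ^ 2 / 16)) := by gcongr
        _ ≤ Pf t * √t * δ * (2000 * Real.exp (-u ^ 2 / 16)) := by gcongr; norm_num
        _ = _ := by ring
    calc _ ≤ _ := key
      _ ≤ δ ^ (β / 2) * (2000 * (Gd t z + Gd t' z)) := by gcongr; linarith
  · have h1 : 1 ≤ δ ^ (β / 2) := Real.one_le_rpow hd (by positivity)
    calc _ ≤ 1000 * Gd t' z + 1000 * Gd t z := (norm_sub_le _ _).trans (add_le_add (K_bound ht' z) (K_bound ht z))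
      _ ≤ 1 * (2000 * (Gd t z + Gd t' z)) := by linarith
      _ ≤ _ := by gcongr

lemma Gd_integral {t : ℝ} (ht : 0 < t) (x : R3) :
    Integrable (fun y => Gd t (x - y)) ∧ ∫ y, Gd t (x - y) = 4 * t ^ (-(1 / 2) : ℝ) := by
  have hb : 0 < 1 / (16 * t) := by positivity
  have hi : Integrable (fun y : R3 => Real.exp (-(1 / (16 * t)) * ‖y‖ ^ 2)) := by
    have h := GaussianFourier.integrable_cexp_neg_mul_sq_norm_add (V := R3)
      (b := ((1 / (16 * t) : ℝ) : ℂ)) (by rw [Complex.ofReal_re]; exact hb) 0 0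
    have := h.norm
    refine this.congr (Eventually.of_forall fun y => ?_)
    simp only [Complex.norm_exp, zero_mul, add_zero]
    congr 1
    rw [← Complex.ofReal_pow, ← Complex.ofReal_neg, ← Complex.ofReal_mul, Complex.ofReal_re]
  have hG : Integrable (Gd t) := hi.const_mul _
  refine ⟨hG.comp_sub_left x, ?_⟩
  rw [integral_sub_left_eq_self (Gd t) volume x]
  unfold Gd
  rw [integral_const_mul, GaussianFourier.integral_rexp_neg_mul_sq_norm hb]
  have h3 : (Module.finrank ℝ R3 : ℝ) / 2 = 3 / 2 := by simp
  rw [h3, Pf]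
  have e1 : π / (1 / (16 * t)) = (4 * π * t) * (2 ^ (2 : ℝ)) := by
    rw [Real.rpow_two]; field_simp; norm_num
  rw [e1, Real.mul_rpow (x := 4 * π * t) (y := 2 ^ (2 : ℝ)) (by positivity) (by positivity), ← Real.rpow_mul (by norm_num)]
  have e2 : (4 * π * t) ^ (-(3 : ℝ) / 2) * (4 * π * t) ^ ((3 : ℝ) / 2) = 1 := by
    rw [← Real.rpow_add (by positivity)]; norm_num
  have e3 : (2 : ℝ) ^ ((2 : ℝ) * (3 / 2)) = 8 := by
    rw [show (2 : ℝ) * (3 / 2) = (3 : ℕ) by norm_num, Real.rpow_natCast]; norm_num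
  have e4 : 1 / t * √t = t ^ (-(1 / 2) : ℝ) := by
    rw [Real.sqrt_eq_rpow, one_div, ← Real.rpow_neg_one, ← Real.rpow_add ht]; norm_num
  rw [e3, ← e4]
  calc _ = 1 / (2 * t) * √t * 8 * ((4 * π * t) ^ (-(3 : ℝ) / 2) * (4 * π * t) ^ ((3 : ℝ) / 2)) := by ring
    _ = _ := by rw [e2]; field_simp; norm_num

lemma meas_K : Measurable (fun p : ℝ × R3 => gradHeatK p.1 p.2) := by
  unfold gradHeatK heatK
  fun_prop

/-- inner integral -/
def FF (f : R3 → ℝ → ℝ) (x : R3) (t s : ℝ) : R3 := ∫ y : R3, f y s • gradHeatK (t - s) (x - y)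

lemma FF_meas {f : R3 → ℝ → ℝ} (hf : Measurable (fun z : R3 × ℝ => f z.1 z.2)) (x : R3) (t : ℝ) :
    StronglyMeasurable (FF f x t) := by
  have h : Measurable (fun p : ℝ × R3 => f p.2 p.1 • gradHeatK (t - p.1) (x - p.2)) := by
    have h1 : Measurable (fun p : ℝ × R3 => f p.2 p.1) := hf.comp measurable_swap
    have h2 : Measurable (fun p : ℝ × R3 => gradHeatK (t - p.1) (x - p.2)) :=
      meas_K.comp (by fun_prop : Measurable (fun p : ℝ × R3 => (t - p.1, x - p.2)))
    exact h1.smul h2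
  exact h.stronglyMeasurable.integral_prod_right

lemma FF_int {f : R3 → ℝ → ℝ} (hf : Measurable (fun z : R3 × ℝ => f z.1 z.2)) {N : ℝ}
    (hN : ∀ x t, |f x t| ≤ N) (x : R3) {t s : ℝ} (h : s < t) :
    Integrable (fun y : R3 => f y s • gradHeatK (t - s) (x - y)) := by
  have hN0 : 0 ≤ N := (abs_nonneg _).trans (hN 0 0)
  have ht : 0 < t - s := by linarith
  refine Integrable.mono' (((Gd_integral ht x).1.const_mul 1000).const_mul N) ?_
    (Eventually.of_forall fun y => ?_)
  · have h1 : Measurable (fun y : R3 => f y s) :=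
      hf.comp (by fun_prop : Measurable (fun y : R3 => (y, s)))
    have h2 : Measurable (fun y : R3 => gradHeatK (t - s) (x - y)) :=
      meas_K.comp (by fun_prop : Measurable (fun y : R3 => (t - s, x - y)))
    exact (h1.smul h2).aestronglyMeasurable
  · rw [norm_smul]
    exact mul_le_mul (hN y s) (K_bound ht _) (norm_nonneg _) hN0

lemma FF_bound {f : R3 → ℝ → ℝ} {N : ℝ}
    (hN : ∀ x t, |f x t| ≤ N) (x : R3) {t s : ℝ} (h : s < t) :
    ‖FF f x t s‖ ≤ 4000 * N * (t - s) ^ (-(1 / 2) : ℝ) := by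
  have hN0 : 0 ≤ N := (abs_nonneg _).trans (hN 0 0)
  have ht : 0 < t - s := by linarith
  refine (norm_integral_le_of_norm_le (((Gd_integral ht x).1.const_mul 1000).const_mul N)
    (Eventually.of_forall fun y => ?_)).trans (le_of_eq ?_)
  · rw [norm_smul]
    exact mul_le_mul (hN y s) (K_bound ht _) (norm_nonneg _) hN0
  · rw [integral_const_mul, integral_const_mul, (Gd_integral ht x).2]; ring

lemma FF_space {f : R3 → ℝ → ℝ} (hf : Measurable (fun z : R3 × ℝ => f z.1 z.2)) {N : ℝ}
    (hN : ∀ x t, |f x t| ≤ N) {β : ℝ} (hβ : β ∈ Ioo (0 : ℝ) 1) (x x' : R3) {t s : ℝ} (h : s < t) :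
    ‖FF f x t s - FF f x' t s‖ ≤ 16000 * N * ‖x - x'‖ ^ β * (t - s) ^ (-((1 + β) / 2) : ℝ) := by
  have hN0 : 0 ≤ N := (abs_nonneg _).trans (hN 0 0)
  have ht : 0 < t - s := by linarith
  have i1 := Gd_integral ht x
  have i2 := Gd_integral ht x'
  unfold FF
  rw [← integral_sub (FF_int hf hN x h) (FF_int hf hN x' h)]
  refine (norm_integral_le_of_norm_le ((((i1.1.add i2.1).const_mul 2000).const_mul
    ((‖x - x'‖ / √(t - s)) ^ β)).const_mul N)
    (Eventually.of_forall fun y => ?_)).trans (le_of_eq ?_)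
  · rw [← smul_sub, norm_smul]
    have := K_space hβ ht (x - y) (x' - y)
    rw [sub_sub_sub_cancel_right] at this
    exact mul_le_mul (hN y s) this (norm_nonneg _) hN0
  · rw [integral_const_mul, integral_const_mul, integral_const_mul]
    simp only [Pi.add_apply]
    rw [integral_add i1.1 i2.1, i1.2, i2.2, Real.div_rpow (norm_nonneg _) (Real.sqrt_nonneg _)]
    rw [Real.sqrt_eq_rpow, ← Real.rpow_mul ht.le, div_eq_mul_inv, ← Real.rpow_neg ht.le]
    rw [show -((1 + β) / 2) = -(1 / 2 * β) + -(1 / 2) by ring, Real.rpow_add ht]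
    ring

lemma FF_time {f : R3 → ℝ → ℝ} (hf : Measurable (fun z : R3 × ℝ => f z.1 z.2)) {N : ℝ}
    (hN : ∀ x t, |f x t| ≤ N) {β : ℝ} (hβ : β ∈ Ioo (0 : ℝ) 1) (x : R3) {t t' s : ℝ} (h : s < t)
    (htt : t ≤ t') :
    ‖FF f x t' s - FF f x t s‖ ≤ 16000 * N * (t' - t) ^ (β / 2) * (t - s) ^ (-((1 + β) / 2) : ℝ) := by
  have hN0 : 0 ≤ N := (abs_nonneg _).trans (hN 0 0)
  have ht : 0 < t - s := by linarith
  have ht' : 0 < t' - s := by linarith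
  have i1 := Gd_integral ht x
  have i2 := Gd_integral ht' x
  unfold FF
  rw [← integral_sub (FF_int hf hN x (h.trans_le htt)) (FF_int hf hN x h)]
  refine (norm_integral_le_of_norm_le ((((i1.1.add i2.1).const_mul 2000).const_mul
    (((t' - t) / (t - s)) ^ (β / 2))).const_mul N)
    (Eventually.of_forall fun y => ?_)).trans ?_
  · rw [← smul_sub, norm_smul]
    have := K_time hβ ht (t' := t' - s) (by linarith) (x - y)
    rw [sub_sub_sub_cancel_right] at this
    exact mul_le_mul (hN y s) this (norm_nonneg _) hN0
  · rw [integral_const_mul, integral_const_mul, integral_const_mul]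
    simp only [Pi.add_apply]
    rw [integral_add i1.1 i2.1, i1.2, i2.2, Real.div_rpow (by linarith) ht.le]
    have hle : (t' - s) ^ (-(1 / 2) : ℝ) ≤ (t - s) ^ (-(1 / 2) : ℝ) :=
      Real.rpow_le_rpow_of_nonpos ht (by linarith) (by norm_num)
    have hp : 0 ≤ (t' - t) ^ (β / 2) := Real.rpow_nonneg (by linarith) _
    calc _ ≤ N * ((t' - t) ^ (β / 2) / (t - s) ^ (β / 2) * (2000 * (4 * (t - s) ^ (-(1 / 2) : ℝ) + 4 * (t - s) ^ (-(1 / 2) : ℝ)))) := by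
          gcongr
      _ = _ := by
          rw [div_eq_mul_inv, ← Real.rpow_neg ht.le]
          rw [show -((1 + β) / 2) = -(β / 2) + -(1 / 2) by ring, Real.rpow_add ht]
          ring

lemma time_int {a b p : ℝ} (hab : a ≤ b) (hp : p < 1) :
    IntegrableOn (fun s => (b - s) ^ (-p)) (Ioo a b) ∧
      ∫ s in Ioo a b, (b - s) ^ (-p) = (b - a) ^ (1 - p) / (1 - p) := by
  have h0 : IntervalIntegrable (fun x : ℝ => x ^ (-p)) volume (b - b) (b - a) :=
    intervalIntegral.intervalIntegrable_rpow' (by linarith)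
  have h1 : IntervalIntegrable (fun s => (b - s) ^ (-p)) volume a b := by
    have := (h0.comp_sub_left b).symm
    simpa using this
  constructor
  · exact ((intervalIntegrable_iff_integrableOn_Ioc_of_le hab).1 h1).mono_set Ioo_subset_Ioc_self
  · rw [← integral_Ioc_eq_integral_Ioo, ← intervalIntegral.integral_of_le hab,
      intervalIntegral.integral_comp_sub_left (fun x : ℝ => x ^ (-p)) b,
      integral_rpow (Or.inl (by linarith))]
    rw [sub_self, show -p + 1 = 1 - p by ring, Real.zero_rpow (by linarith), sub_zero]

lemma FF_intOn {f : R3 → ℝ → ℝ} (hf : Measurable (fun z : R3 × ℝ => f z.1 z.2)) {N : ℝ}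
    (hN : ∀ x t, |f x t| ≤ N) (x : R3) {a t : ℝ} (h : a ≤ t) :
    IntegrableOn (FF f x t) (Ioo a t) := by
  refine Integrable.mono' ((time_int (p := 1 / 2) h (by norm_num)).1.const_mul (4000 * N))
    (FF_meas hf x t).aestronglyMeasurable ?_
  exact (ae_restrict_iff' measurableSet_Ioo).2 (Eventually.of_forall fun s hs => FF_bound hN x hs.2)

lemma FF_intbound {f : R3 → ℝ → ℝ} {N : ℝ}
    (hN : ∀ x t, |f x t| ≤ N) (x : R3) {a t : ℝ} (h : a ≤ t) :
    ‖∫ s in Ioo a t, FF f x t s‖ ≤ 8000 * N * (t - a) ^ (1 / 2 : ℝ) := by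
  have hi := time_int (p := 1 / 2) h (by norm_num)
  refine (norm_integral_le_of_norm_le (hi.1.const_mul (4000 * N)) ?_).trans (le_of_eq ?_)
  · exact (ae_restrict_iff' measurableSet_Ioo).2 (Eventually.of_forall fun s hs => FF_bound hN x hs.2)
  · rw [integral_const_mul, hi.2, show (1 : ℝ) - 1 / 2 = 1 / 2 by norm_num]; ring

lemma diff_bound {A β t : ℝ} {g : ℝ → R3} (hA : 0 ≤ A) (hβ : β ∈ Ioo (0 : ℝ) 1) (ht : t ∈ Icc (0 : ℝ) 1)
    (hg : ∀ s < t, ‖g s‖ ≤ A * (t - s) ^ (-((1 + β) / 2) : ℝ)) :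
    ‖∫ s in Ioo 0 t, g s‖ ≤ A * (2 / (1 - β)) := by
  have hb := hβ.2
  have hi := time_int (a := 0) (b := t) (p := (1 + β) / 2) ht.1 (by linarith)
  refine (norm_integral_le_of_norm_le (hi.1.const_mul A) ?_).trans ?_
  · exact (ae_restrict_iff' measurableSet_Ioo).2 (Eventually.of_forall fun s hs => hg s hs.2)
  · rw [integral_const_mul, hi.2]
    refine mul_le_mul_of_nonneg_left ?_ hA
    rw [show 1 - (1 + β) / 2 = (1 - β) / 2 by ring, sub_zero, div_div_eq_mul_div]
    have : t ^ ((1 - β) / 2) ≤ 1 := Real.rpow_le_one ht.1 ht.2 (by linarith)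
    have h1 : 0 < 1 - β := by linarith
    gcongr
    linarith

lemma time_diff {f : R3 → ℝ → ℝ} (hf : Measurable (fun z : R3 × ℝ => f z.1 z.2)) {N : ℝ}
    (hN : ∀ x t, |f x t| ≤ N) {β : ℝ} (hβ : β ∈ Ioo (0 : ℝ) 1) (x : R3) {t t' : ℝ}
    (ht : t ∈ Icc (0 : ℝ) 1) (ht' : t' ∈ Icc (0 : ℝ) 1) (htt : t ≤ t') :
    ‖(∫ s in Ioo 0 t', FF f x t' s) - ∫ s in Ioo 0 t, FF f x t s‖ ≤
      (16000 * N * (2 / (1 - β)) + 8000 * N) * (t' - t) ^ (β / 2) := by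
  have hN0 : 0 ≤ N := (abs_nonneg _).trans (hN 0 0)
  have hd0 : 0 ≤ t' - t := by linarith
  have hI := FF_intOn hf hN x ht'.1
  have hsplit : ∫ s in Ioo 0 t', FF f x t' s =
      (∫ s in Ioo 0 t, FF f x t' s) + ∫ s in Ioo t t', FF f x t' s := by
    rw [← integral_Ioc_eq_integral_Ioo, ← integral_Ioc_eq_integral_Ioo, ← integral_Ioc_eq_integral_Ioo,
      ← Ioc_union_Ioc_eq_Ioc ht.1 htt]
    have hI : IntegrableOn (FF f x t') (Ioc 0 t') := by
      rw [integrableOn_Ioc_iff_integrableOn_Ioo]; exact hI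
    exact setIntegral_union (Ioc_disjoint_Ioc_of_le le_rfl) measurableSet_Ioc
      (hI.mono_set (Ioc_subset_Ioc_right htt)) (hI.mono_set (Ioc_subset_Ioc_left ht.1))
  rw [hsplit, add_sub_right_comm, ← integral_sub (hI.mono_set (Ioo_subset_Ioo_right htt))
    (FF_intOn hf hN x ht.1)]
  have hp : 0 ≤ (t' - t) ^ (β / 2) := Real.rpow_nonneg hd0 _
  have b1 := diff_bound (A := 16000 * N * (t' - t) ^ (β / 2)) (by positivity) hβ ht
    (fun s hs => FF_time hf hN hβ x hs htt)
  have b2 := FF_intbound hN x htt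
  have b3 : (t' - t) ^ (1 / 2 : ℝ) ≤ (t' - t) ^ (β / 2) := by
    have hb := hβ.2
    rcases hd0.eq_or_lt with h0 | h0
    · rw [← h0, Real.zero_rpow (by norm_num)]; exact Real.rpow_nonneg le_rfl _
    · exact Real.rpow_le_rpow_of_exponent_ge h0 (by linarith [ht'.2, ht.1]) (by linarith)
  calc _ ≤ _ := norm_add_le _ _
    _ ≤ 16000 * N * (t' - t) ^ (β / 2) * (2 / (1 - β)) + 8000 * N * (t' - t) ^ (β / 2) := by
        refine add_le_add b1 (b2.trans ?_)
        gcongr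
    _ = _ := by ring

/-- parabolic Hölder regularity of `∫₀ᵗ ∇e^{Δ(t−s)} f(·,s) ds` for bounded `f`. -/
theorem stmt11 (β : ℝ) (hβ : β ∈ Set.Ioo (0 : ℝ) 1) :
    ∃ C : ℝ, 0 < C ∧
      ∀ f : R3 → ℝ → ℝ,
        Measurable (fun z : R3 × ℝ => f z.1 z.2) →
        ∀ N : ℝ, (∀ x : R3, ∀ t : ℝ, |f x t| ≤ N) →
        ∀ v : R3 → ℝ → R3,
          (∀ x : R3, ∀ t : ℝ,
            v x t = ∫ s in Ioo (0 : ℝ) t, ∫ y : R3, f y s • gradHeatK (t - s) (x - y)) →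
          (∀ x : R3, ∀ t ∈ Icc (0 : ℝ) 1, ‖v x t‖ ≤ C * N) ∧
          (∀ x x' : R3, ∀ t ∈ Icc (0 : ℝ) 1, ∀ t' ∈ Icc (0 : ℝ) 1,
            ‖v x t - v x' t'‖ ≤ C * N * pdist (x, t) (x', t') ^ β) := by
  have hb1 : 0 < 1 - β := by linarith [hβ.2]
  refine ⟨32000 * (2 / (1 - β)) + 8000, by positivity, ?_⟩
  intro f hf N hN v hv
  have hN0 : 0 ≤ N := (abs_nonneg _).trans (hN 0 0)
  have hc : 0 ≤ 2 / (1 - β) := by positivity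
  have hv' : ∀ x t, v x t = ∫ s in Ioo (0 : ℝ) t, FF f x t s := hv
  constructor
  · intro x t ht
    rw [hv']
    refine (FF_intbound hN x ht.1).trans ?_
    have : (t - 0) ^ (1 / 2 : ℝ) ≤ 1 := Real.rpow_le_one (by linarith [ht.1]) (by linarith [ht.2]) (by norm_num)
    calc 8000 * N * (t - 0) ^ (1 / 2 : ℝ) ≤ 8000 * N * 1 := by gcongr
      _ ≤ _ := by nlinarith [mul_nonneg hc hN0]
  · -- time estimate, symmetric in the two times
    have htime : ∀ x : R3, ∀ t ∈ Icc (0 : ℝ) 1, ∀ t' ∈ Icc (0 : ℝ) 1,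
        ‖v x t - v x t'‖ ≤ (16000 * N * (2 / (1 - β)) + 8000 * N) * |t - t'| ^ (β / 2) := by
      intro x t ht t' ht'
      rw [hv', hv']
      rcases le_total t t' with h | h
      · rw [norm_sub_rev, abs_sub_comm, abs_of_nonneg (by linarith)]
        exact time_diff hf hN hβ x ht ht' h
      · rw [abs_of_nonneg (by linarith)]
        exact time_diff hf hN hβ x ht' ht h
    intro x x' t ht t' ht'
    have hspace : ‖v x t - v x' t‖ ≤ 16000 * N * ‖x - x'‖ ^ β * (2 / (1 - β)) := by
      rw [hv', hv', ← integral_sub (FF_intOn hf hN x ht.1) (FF_intOn hf hN x' ht.1)]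
      exact diff_bound (by positivity) hβ ht (fun s hs => FF_space hf hN hβ x x' hs)
    have d1 : ‖x - x'‖ ^ β ≤ pdist (x, t) (x', t') ^ β := by
      apply Real.rpow_le_rpow (norm_nonneg _) _ hβ.1.le
      simp only [pdist]
      linarith [Real.sqrt_nonneg |t - t'|]
    have d2 : |t - t'| ^ (β / 2) ≤ pdist (x, t) (x', t') ^ β := by
      have : |t - t'| ^ (β / 2) = (√|t - t'|) ^ β := by
        rw [Real.sqrt_eq_rpow, ← Real.rpow_mul (abs_nonneg _)]; congr 1; ring
      rw [this]
      apply Real.rpow_le_rpow (Real.sqrt_nonneg _) _ hβ.1.le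
      simp only [pdist]
      linarith [norm_nonneg (x - x')]
    have := htime x' t ht t' ht'
    calc ‖v x t - v x' t'‖ = ‖(v x t - v x' t) + (v x' t - v x' t')‖ := by congr 1; abel
      _ ≤ _ := norm_add_le _ _
      _ ≤ 16000 * N * pdist (x, t) (x', t') ^ β * (2 / (1 - β))
          + (16000 * N * (2 / (1 - β)) + 8000 * N) * pdist (x, t) (x', t') ^ β := by
        refine add_le_add (hspace.trans ?_) (this.trans ?_) <;> gcongr
      _ = _ := by ring
end
end

section
/- There exists a constant C > 0 such that for all α, β ∈ {3,4} and all x ∈ ℝ³ with R := |x| > 8: ∫₀¹ ∫_{ℝ³} (|x−y| + √(1−t))^{−α} · (|y| + √t)^{−β} dy dt ≤ C·R^{−3}·log R if α = β = 3, and ∫₀¹ ∫_{ℝ³} (|x−y| + √(1−t))^{−α} · (|y| + √t)^{−β} dy dt ≤ C·R^{4−α−β} otherwise (i.e. when α + β ≥ 7). -/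
open MeasureTheory Real Filter Set Metric

noncomputable section

/-- one-dimensional radial integral -/
lemma aux_radial {e s : ℝ} (he : 0 < e) (hs : 0 < s) :
    (∫ r in Ioi (0 : ℝ), (r + s) ^ (-1 - e)) = s ^ (-e) / e := by
  have hd : ∀ x ∈ Ici (0 : ℝ),
      HasDerivAt (fun t : ℝ => (t + s) ^ (-e) / (-e)) ((x + s) ^ (-1 - e)) x := by
    intro x hx
    have hx' : 0 < x + s := by linarith [mem_Ici.mp hx]
    have h1 := (((hasDerivAt_id x).add_const s).rpow_const (p := -e)
      (Or.inl (by simpa using hx'.ne'))).div_const (-e)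
    convert! h1 using 1
    have : -e - 1 = -1 - e := by ring
    simp only [id, this]
    field_simp
  have ht : Tendsto (fun t : ℝ => (t + s) ^ (-e) / (-e)) atTop (nhds (0 / (-e))) := by
    apply Tendsto.div_const
    exact (tendsto_rpow_neg_atTop he).comp (tendsto_atTop_add_const_right _ _ tendsto_id)
  rw [integral_Ioi_of_hasDerivAt_of_tendsto' hd
    (integrableOn_add_rpow_Ioi_of_lt (by linarith) (by linarith)) ht]
  simp only [zero_add, zero_div]
  field_simp
  ring

/-- volume of the unit ball, times three -/
def cB : ℝ := 3 * (volume : Measure R3).real (ball 0 1)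

lemma cB_nonneg : 0 ≤ cB := by unfold cB; positivity

lemma aux_le {e s r : ℝ} (hs : 0 < s) (hr : 0 < r) :
    r ^ 2 * (r + s) ^ (-3 - e) ≤ (r + s) ^ (-1 - e) := by
  have h : (r + s) ^ (-1 - e) = (r + s) ^ 2 * (r + s) ^ (-3 - e) := by
    rw [← Real.rpow_natCast (r + s) 2, ← Real.rpow_add (by linarith)]
    congr 1
    push_cast
    ring
  rw [h]
  have : 0 ≤ (r + s) ^ (-3 - e) := Real.rpow_nonneg (by linarith) _
  gcongr
  linarith

lemma aux_intOn {e s : ℝ} (he : 0 < e) (hs : 0 < s) :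
    IntegrableOn (fun r : ℝ => r ^ 2 * (r + s) ^ (-3 - e)) (Ioi 0) := by
  have h := integrableOn_add_rpow_Ioi_of_lt (a := -1 - e) (c := 0) (m := s)
    (by linarith) (by linarith)
  refine Integrable.mono' h (by fun_prop) ?_
  filter_upwards [ae_restrict_mem measurableSet_Ioi] with r hr
  have hr : 0 < r := hr
  rw [Real.norm_of_nonneg (by positivity)]
  exact aux_le hs hr

lemma aux_space_int {e s : ℝ} (he : 0 < e) (hs : 0 < s) :
    Integrable (fun y : R3 => (‖y‖ + s) ^ (-3 - e)) := by
  have := (integrable_fun_norm_addHaar (volume : Measure R3)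
    (f := fun r : ℝ => (r + s) ^ (-3 - e))).2
  apply this
  simpa using aux_intOn he hs

lemma aux_space {e s : ℝ} (he : 0 < e) (hs : 0 < s) :
    (∫ y : R3, (‖y‖ + s) ^ (-3 - e)) ≤ cB * (s ^ (-e) / e) := by
  rw [integral_fun_norm_addHaar (volume : Measure R3) (fun r : ℝ => (r + s) ^ (-3 - e))]
  simp only [finrank_euclideanSpace, Fintype.card_fin, smul_eq_mul, nsmul_eq_mul]
  rw [← aux_radial he hs, cB, mul_assoc]
  push_cast
  refine mul_le_mul_of_nonneg_left (mul_le_mul_of_nonneg_left ?_ measureReal_nonneg) (by norm_num)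
  refine setIntegral_mono_on (aux_intOn he hs)
    (integrableOn_add_rpow_Ioi_of_lt (a := -1 - e) (by linarith) (by linarith))
    measurableSet_Ioi ?_
  intro r hr
  exact aux_le hs hr

/-- the space-time weight -/
def Fw (e : ℝ) (z : R3 × ℝ) : ℝ := (‖z.1‖ + Real.sqrt z.2) ^ (-3 - e)

lemma Fw_nonneg (e : ℝ) (z : R3 × ℝ) : 0 ≤ Fw e z := by unfold Fw; positivity

/-- the space-time slab -/
def slab : Set (R3 × ℝ) := (univ : Set R3) ×ˢ Ioo (0 : ℝ) 1

lemma slab_meas : MeasurableSet slab := MeasurableSet.univ.prod measurableSet_Ioo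

lemma slab_restrict : (volume : Measure (R3 × ℝ)).restrict slab =
    (volume : Measure R3).prod ((volume : Measure ℝ).restrict (Ioo 0 1)) := by
  rw [slab, Measure.volume_eq_prod, ← Measure.prod_restrict, Measure.restrict_univ]

lemma aux_time : IntegrableOn (fun t : ℝ => t ^ (-(1 / 2) : ℝ)) (Ioo 0 1) := by
  rw [intervalIntegral.integrableOn_Ioo_rpow_iff one_pos]; norm_num

lemma aux_time_val : (∫ t in Ioo (0 : ℝ) 1, t ^ (-(1 / 2) : ℝ)) = 2 := by
  rw [← integral_Ioc_eq_integral_Ioo, ← intervalIntegral.integral_of_le zero_le_one,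
    integral_rpow (Or.inl (by norm_num))]
  norm_num

lemma aux_inner {e t : ℝ} (he : 0 < e) (he1 : e ≤ 1) (ht : t ∈ Ioo (0 : ℝ) 1) :
    (∫ y : R3, Fw e (y, t)) ≤ cB / e * t ^ (-(1 / 2) : ℝ) := by
  have hs : 0 < Real.sqrt t := Real.sqrt_pos.2 ht.1
  refine (aux_space he hs).trans ?_
  have h1 : Real.sqrt t ^ (-e) ≤ t ^ (-(1 / 2) : ℝ) := by
    rw [Real.sqrt_eq_rpow, ← Real.rpow_mul ht.1.le]
    apply Real.rpow_le_rpow_of_exponent_ge ht.1 ht.2.le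
    linarith
  have := cB_nonneg
  calc cB * (Real.sqrt t ^ (-e) / e) = cB / e * Real.sqrt t ^ (-e) := by ring
    _ ≤ _ := by gcongr

lemma Fw_meas (e : ℝ) : Measurable (Fw e) := by unfold Fw; fun_prop

lemma Fw_int {e : ℝ} (he : 0 < e) (he1 : e ≤ 1) : IntegrableOn (Fw e) slab := by
  rw [IntegrableOn, slab_restrict, integrable_prod_iff' (Fw_meas e).aestronglyMeasurable]
  constructor
  · filter_upwards [ae_restrict_mem measurableSet_Ioo] with t ht
    exact aux_space_int he (Real.sqrt_pos.2 ht.1)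
  · refine Integrable.mono' (aux_time.const_mul (cB / e)) ?_ ?_
    · exact ((Fw_meas e).norm.stronglyMeasurable.integral_prod_left'
        (μ := (volume : Measure R3))).aestronglyMeasurable
    · filter_upwards [ae_restrict_mem measurableSet_Ioo] with t ht
      simp only [Real.norm_of_nonneg (Fw_nonneg e _)]
      rw [Real.norm_of_nonneg (integral_nonneg fun y => Fw_nonneg e _)]
      exact aux_inner he he1 ht

lemma Fw_bound {e : ℝ} (he : 0 < e) (he1 : e ≤ 1) :
    (∫ z in slab, Fw e z) ≤ 2 * cB / e := by
  have hI := Fw_int he he1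
  rw [IntegrableOn, slab_restrict] at hI
  rw [slab_restrict, integral_prod_symm _ hI]
  calc _ ≤ ∫ t in Ioo (0 : ℝ) 1, cB / e * t ^ (-(1 / 2) : ℝ) :=
        setIntegral_mono_on hI.integral_prod_right (aux_time.const_mul (cB / e)) measurableSet_Ioo
          fun t ht => aux_inner he he1 ht
    _ = _ := by rw [integral_const_mul, aux_time_val]; ring

lemma refl_mp (x : R3) : MeasurePreserving (fun z : R3 × ℝ => ((x, (1 : ℝ)) - z)) volume volume :=
  (Measure.measurePreserving_sub_left (volume : Measure R3) x).prod
    (Measure.measurePreserving_sub_left (volume : Measure ℝ) 1)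

lemma refl_emb (x : R3) : MeasurableEmbedding (fun z : R3 × ℝ => ((x, (1 : ℝ)) - z)) :=
  (Homeomorph.subLeft ((x, (1 : ℝ)) : R3 × ℝ)).measurableEmbedding

lemma refl_pre (x : R3) : (fun z : R3 × ℝ => ((x, (1 : ℝ)) - z)) ⁻¹' slab = slab := by
  ext z
  simp only [slab, mem_preimage, mem_prod, mem_univ, true_and, mem_Ioo, Prod.snd_sub]
  constructor <;> rintro ⟨h1, h2⟩ <;> constructor <;> linarith

lemma Fr_int {e : ℝ} (he : 0 < e) (he1 : e ≤ 1) (x : R3) :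
    IntegrableOn (fun z => Fw e ((x, (1 : ℝ)) - z)) slab := by
  have := ((refl_mp x).integrableOn_comp_preimage (refl_emb x) (f := Fw e) (s := slab)).2
    (Fw_int he he1)
  rwa [refl_pre] at this

lemma Fr_bound {e : ℝ} (he : 0 < e) (he1 : e ≤ 1) (x : R3) :
    (∫ z in slab, Fw e ((x, (1 : ℝ)) - z)) ≤ 2 * cB / e := by
  have := (refl_mp x).setIntegral_preimage_emb (refl_emb x) (Fw e) slab
  rw [refl_pre] at this
  rw [this]
  exact Fw_bound he he1

lemma aux_half {a b e R A B : ℝ} (ha : a ≤ 4) (ha3 : 3 ≤ a) (hb3 : 3 ≤ b)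
    (he1 : e ≤ 1) (hb : b ≤ 3 + e) (hR : 0 < R) (hA : 0 < A) (hB : 0 < B)
    (h1 : R / 4 ≤ A) (h2 : B / 4 ≤ A) :
    A ^ (-a) * B ^ (-b) ≤ 256 * R ^ (-(a + b - 3 - e)) * B ^ (-3 - e) := by
  have e1 : A ^ (-a) = A ^ (-(a + b - 3 - e)) * A ^ (-(3 + e - b)) := by
    rw [← Real.rpow_add hA]; congr 1; ring
  have e2 : A ^ (-(a + b - 3 - e)) ≤ (R / 4) ^ (-(a + b - 3 - e)) :=
    Real.rpow_le_rpow_of_nonpos (by positivity) h1 (by linarith)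
  have e3 : A ^ (-(3 + e - b)) ≤ (B / 4) ^ (-(3 + e - b)) :=
    Real.rpow_le_rpow_of_nonpos (by positivity) h2 (by linarith)
  have e4 : (4 : ℝ) ^ a ≤ 256 := by
    calc (4 : ℝ) ^ a ≤ 4 ^ (4 : ℝ) := Real.rpow_le_rpow_of_exponent_le (by norm_num) ha
      _ = 256 := by norm_num
  have e5 : (R / 4) ^ (-(a + b - 3 - e)) = R ^ (-(a + b - 3 - e)) * 4 ^ (a + b - 3 - e) := by
    rw [Real.div_rpow hR.le (by norm_num), Real.rpow_neg (by norm_num : (0 : ℝ) ≤ 4)]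
    field_simp
  have e6 : (B / 4) ^ (-(3 + e - b)) = B ^ (-(3 + e - b)) * 4 ^ (3 + e - b) := by
    rw [Real.div_rpow hB.le (by norm_num), Real.rpow_neg (by norm_num : (0 : ℝ) ≤ 4)]
    field_simp
  have e7 : (4 : ℝ) ^ a = 4 ^ (a + b - 3 - e) * 4 ^ (3 + e - b) := by
    rw [← Real.rpow_add (by norm_num)]; congr 1; ring
  have e8 : B ^ (-3 - e) = B ^ (-(3 + e - b)) * B ^ (-b) := by
    rw [← Real.rpow_add hB]; congr 1; ring
  calc A ^ (-a) * B ^ (-b)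
      ≤ ((R / 4) ^ (-(a + b - 3 - e)) * (B / 4) ^ (-(3 + e - b))) * B ^ (-b) := by
        rw [e1]; gcongr
    _ = 4 ^ a * R ^ (-(a + b - 3 - e)) * B ^ (-3 - e) := by
        rw [e5, e6, e7, e8]; ring
    _ ≤ _ := by gcongr

lemma aux_point {a b e : ℝ} {x : R3} (ha : a ≤ 4) (ha3 : 3 ≤ a) (hb4 : b ≤ 4) (hb3 : 3 ≤ b)
    (he1 : e ≤ 1) (hae : a ≤ 3 + e) (hbe : b ≤ 3 + e) (hx : 8 < ‖x‖)
    {z : R3 × ℝ} (hz : z ∈ slab) :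
    (‖x - z.1‖ + Real.sqrt (1 - z.2)) ^ (-a) * (‖z.1‖ + Real.sqrt z.2) ^ (-b) ≤
      256 * ‖x‖ ^ (-(a + b - 3 - e)) * (Fw e z + Fw e ((x, (1 : ℝ)) - z)) := by
  obtain ⟨-, h0, h1⟩ := hz
  have hsA : 0 < Real.sqrt (1 - z.2) := Real.sqrt_pos.2 (by linarith)
  have hsB : 0 < Real.sqrt z.2 := Real.sqrt_pos.2 h0
  have hsA1 : Real.sqrt (1 - z.2) ≤ 1 := Real.sqrt_le_one.2 (by linarith)
  have hsB1 : Real.sqrt z.2 ≤ 1 := Real.sqrt_le_one.2 h1.le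
  have n1 : ‖x‖ ≤ ‖x - z.1‖ + ‖z.1‖ := by
    simpa using norm_add_le (x - z.1) z.1
  have n2 : ‖z.1‖ ≤ ‖x‖ + ‖x - z.1‖ := by
    simpa using norm_sub_le x (x - z.1)
  have n3 : ‖x - z.1‖ ≤ ‖x‖ + ‖z.1‖ := norm_sub_le _ _
  have f1 := Fw_nonneg e z
  have f2 := Fw_nonneg e ((x, (1 : ℝ)) - z)
  have hF : Fw e ((x, (1 : ℝ)) - z) = (‖x - z.1‖ + Real.sqrt (1 - z.2)) ^ (-3 - e) := rfl
  have hF' : Fw e z = (‖z.1‖ + Real.sqrt z.2) ^ (-3 - e) := rfl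
  have hRp : 0 ≤ 256 * ‖x‖ ^ (-(a + b - 3 - e)) := by positivity
  have p1 := norm_nonneg (x - z.1)
  have p2 := norm_nonneg z.1
  rcases le_total (‖x‖ / 2) (‖x - z.1‖ + Real.sqrt (1 - z.2)) with h | h
  · refine (aux_half (e := e) (R := ‖x‖) ha ha3 hb3 he1 hbe (by linarith) (by linarith) (by linarith)
      (by linarith) (by linarith)).trans ?_
    rw [← hF']
    gcongr
    linarith
  · rw [mul_comm]
    refine (aux_half (e := e) (R := ‖x‖) hb4 hb3 ha3 he1 hae (by linarith) (by linarith) (by linarith)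
      (by linarith) (by linarith)).trans ?_
    rw [← hF, add_comm b a]
    gcongr
    linarith

lemma aux_main {a b e : ℝ} {x : R3} (ha : a ≤ 4) (ha3 : 3 ≤ a) (hb4 : b ≤ 4) (hb3 : 3 ≤ b)
    (he : 0 < e) (he1 : e ≤ 1) (hae : a ≤ 3 + e) (hbe : b ≤ 3 + e) (hx : 8 < ‖x‖) :
    (∫ z in ((univ : Set R3) ×ˢ Ioo (0 : ℝ) 1),
      (‖x - z.1‖ + Real.sqrt (1 - z.2)) ^ (-a) * (‖z.1‖ + Real.sqrt z.2) ^ (-b)) ≤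
      1024 * cB * ‖x‖ ^ (-(a + b - 3 - e)) / e := by
  change (∫ z in slab, _) ≤ _
  have hI := (Fw_int he he1).add (Fr_int he he1 x)
  calc _ ≤ ∫ z in slab, 256 * ‖x‖ ^ (-(a + b - 3 - e)) * (Fw e z + Fw e ((x, (1 : ℝ)) - z)) := by
        refine integral_mono_of_nonneg ?_ (hI.const_mul _) ?_
        · filter_upwards with z
          simp only [Pi.zero_apply]
          positivity
        · filter_upwards [ae_restrict_mem slab_meas] with z hz
          exact aux_point ha ha3 hb4 hb3 he1 hae hbe hx hz
    _ = 256 * ‖x‖ ^ (-(a + b - 3 - e)) *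
        ((∫ z in slab, Fw e z) + ∫ z in slab, Fw e ((x, (1 : ℝ)) - z)) := by
        rw [integral_const_mul, integral_add (Fw_int he he1) (Fr_int he he1 x)]
    _ ≤ 256 * ‖x‖ ^ (-(a + b - 3 - e)) * (2 * cB / e + 2 * cB / e) := by
        gcongr
        · exact Fw_bound he he1
        · exact Fr_bound he he1 x
    _ = _ := by ring

/-- the space-time kernel integral estimate. -/
theorem stmt17 :
    ∃ C : ℝ, 0 < C ∧
      ∀ a b : ℝ, (a = 3 ∨ a = 4) → (b = 3 ∨ b = 4) → ∀ x : R3, 8 < ‖x‖ →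
        (a = 3 ∧ b = 3 →
          (∫ z in ((univ : Set R3) ×ˢ Ioo (0 : ℝ) 1),
              (‖x - z.1‖ + Real.sqrt (1 - z.2)) ^ (-a) * (‖z.1‖ + Real.sqrt z.2) ^ (-b)) ≤
            C * ‖x‖ ^ (-(3 : ℝ)) * Real.log ‖x‖) ∧
        (¬(a = 3 ∧ b = 3) →
          (∫ z in ((univ : Set R3) ×ˢ Ioo (0 : ℝ) 1),
              (‖x - z.1‖ + Real.sqrt (1 - z.2)) ^ (-a) * (‖z.1‖ + Real.sqrt z.2) ^ (-b)) ≤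
            C * ‖x‖ ^ (4 - a - b)) := by
  have hc := cB_nonneg
  refine ⟨1024 * cB * Real.exp 1 + 1, by positivity, ?_⟩
  intro a b ha hb x hx
  have ha3 : 3 ≤ a := by rcases ha with h | h <;> rw [h] <;> norm_num
  have ha4 : a ≤ 4 := by rcases ha with h | h <;> rw [h] <;> norm_num
  have hb3 : 3 ≤ b := by rcases hb with h | h <;> rw [h] <;> norm_num
  have hb4 : b ≤ 4 := by rcases hb with h | h <;> rw [h] <;> norm_num
  have hx0 : 0 < ‖x‖ := by linarith
  constructor
  · rintro ⟨rfl, rfl⟩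
    have hL : 1 ≤ Real.log ‖x‖ := by
      rw [Real.le_log_iff_exp_le hx0]
      linarith [Real.exp_one_lt_d9]
    have hL0 : 0 < Real.log ‖x‖ := by linarith
    have hinv : 0 < 1 / Real.log ‖x‖ := by positivity
    refine (aux_main (e := 1 / Real.log ‖x‖) ha4 ha3 hb4 hb3 hinv
      (by rw [div_le_one hL0]; exact hL) (by linarith) (by linarith) hx).trans ?_
    have h1 : ‖x‖ ^ (-(3 + 3 - 3 - 1 / Real.log ‖x‖)) = ‖x‖ ^ (-(3 : ℝ)) * Real.exp 1 := by
      have : Real.exp 1 = ‖x‖ ^ (1 / Real.log ‖x‖) := by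
        rw [Real.rpow_def_of_pos hx0]
        congr 1
        field_simp
      rw [this, ← Real.rpow_add hx0]
      congr 1
      ring
    rw [h1]
    have h2 : 0 ≤ ‖x‖ ^ (-(3 : ℝ)) * Real.log ‖x‖ := by positivity
    calc _ = 1024 * cB * Real.exp 1 * (‖x‖ ^ (-(3 : ℝ)) * Real.log ‖x‖) := by
          field_simp
      _ ≤ (1024 * cB * Real.exp 1 + 1) * (‖x‖ ^ (-(3 : ℝ)) * Real.log ‖x‖) := by
          gcongr; linarith
      _ = _ := by ring
  · intro _
    refine (aux_main (e := 1) ha4 ha3 hb4 hb3 one_pos le_rfl (by linarith) (by linarith) hx).trans ?_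
    have h1 : -(a + b - 3 - 1) = 4 - a - b := by ring
    rw [h1, div_one]
    have h2 : 1024 * cB ≤ 1024 * cB * Real.exp 1 + 1 := by
      nlinarith [Real.add_one_le_exp (1 : ℝ)]
    gcongr
end
end
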